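/- arXiv:0911.1755 — 7 statements merged into one kernel-verified Lean document; each statement's English description precedes it below -/
import Mathlib

section
/- Let (U,A) be an intuitionistic fuzzy normed linear space over ℝ and let (V,B) be an intuitionistic fuzzy normed linear space over ℝ whose underlying linear space is ℝ itself (so that products of function values are defined), both with respect to the same continuous t-norm ∗ and continuous t-conorm ⋄ satisfying condition (xii), and suppose B satisfies conditions (xv) and (xvi). If f : U → ℝ and g : U → ℝ are sequentially intuitionistic fuzzy continuous on U, then the product function f·g is sequentially intuitionistic fuzzy continuous on U. -/
open Filter Topology Set

/-- A continuous t-norm: a continuous, commutative, associative, monotone binary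
operation on `[0,1]` with `a ∗ 1 = a`. -/
structure IsContinuousTNorm (star : ℝ → ℝ → ℝ) : Prop where
  mem : ∀ a ∈ Icc (0:ℝ) 1, ∀ b ∈ Icc (0:ℝ) 1, star a b ∈ Icc (0:ℝ) 1
  comm : ∀ a ∈ Icc (0:ℝ) 1, ∀ b ∈ Icc (0:ℝ) 1, star a b = star b a
  assoc : ∀ a ∈ Icc (0:ℝ) 1, ∀ b ∈ Icc (0:ℝ) 1, ∀ c ∈ Icc (0:ℝ) 1,
    star (star a b) c = star a (star b c)
  continuousOn : ContinuousOn (fun p : ℝ × ℝ => star p.1 p.2) (Icc 0 1 ×ˢ Icc 0 1)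
  star_one : ∀ a ∈ Icc (0:ℝ) 1, star a 1 = a
  mono : ∀ a ∈ Icc (0:ℝ) 1, ∀ b ∈ Icc (0:ℝ) 1, ∀ c ∈ Icc (0:ℝ) 1, ∀ d ∈ Icc (0:ℝ) 1,
    a ≤ c → b ≤ d → star a b ≤ star c d

/-- A continuous t-conorm: a continuous, commutative, associative, monotone binary
operation on `[0,1]` with `a ⋄ 0 = a`. -/
structure IsContinuousTConorm (dia : ℝ → ℝ → ℝ) : Prop where
  mem : ∀ a ∈ Icc (0:ℝ) 1, ∀ b ∈ Icc (0:ℝ) 1, dia a b ∈ Icc (0:ℝ) 1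
  comm : ∀ a ∈ Icc (0:ℝ) 1, ∀ b ∈ Icc (0:ℝ) 1, dia a b = dia b a
  assoc : ∀ a ∈ Icc (0:ℝ) 1, ∀ b ∈ Icc (0:ℝ) 1, ∀ c ∈ Icc (0:ℝ) 1,
    dia (dia a b) c = dia a (dia b c)
  continuousOn : ContinuousOn (fun p : ℝ × ℝ => dia p.1 p.2) (Icc 0 1 ×ˢ Icc 0 1)
  dia_zero : ∀ a ∈ Icc (0:ℝ) 1, dia a 0 = a
  mono : ∀ a ∈ Icc (0:ℝ) 1, ∀ b ∈ Icc (0:ℝ) 1, ∀ c ∈ Icc (0:ℝ) 1, ∀ d ∈ Icc (0:ℝ) 1,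
    a ≤ c → b ≤ d → dia a b ≤ dia c d

/-- An intuitionistic fuzzy norm on a linear space `V` over `𝕜` (= ℝ or ℂ), with respect to a
continuous t-norm `star` and continuous t-conorm `dia`: membership degree `μ` and
non-membership degree `ν` on `V × ℝ⁺` satisfying axioms (i)–(xi). -/
structure IFNorm (𝕜 : Type*) [RCLike 𝕜] (V : Type*) [AddCommGroup V] [Module 𝕜 V]
    (star dia : ℝ → ℝ → ℝ) where
  μ : V → ℝ → ℝ
  ν : V → ℝ → ℝ
  μ_mem : ∀ x : V, ∀ t > (0:ℝ), μ x t ∈ Icc (0:ℝ) 1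
  ν_mem : ∀ x : V, ∀ t > (0:ℝ), ν x t ∈ Icc (0:ℝ) 1
  sum_le_one : ∀ x : V, ∀ t > (0:ℝ), μ x t + ν x t ≤ 1
  μ_pos : ∀ x : V, ∀ t > (0:ℝ), 0 < μ x t
  μ_eq_one_iff : ∀ x : V, ∀ t > (0:ℝ), (μ x t = 1 ↔ x = 0)
  μ_smul : ∀ c : 𝕜, c ≠ 0 → ∀ x : V, ∀ t > (0:ℝ), μ (c • x) t = μ x (t / ‖c‖)
  μ_add : ∀ x y : V, ∀ s > (0:ℝ), ∀ t > (0:ℝ), star (μ x s) (μ y t) ≤ μ (x + y) (s + t)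
  μ_mono : ∀ x : V, MonotoneOn (μ x) (Ioi 0)
  μ_tendsto : ∀ x : V, Tendsto (μ x) atTop (𝓝 1)
  ν_lt_one : ∀ x : V, ∀ t > (0:ℝ), ν x t < 1
  ν_eq_zero_iff : ∀ x : V, ∀ t > (0:ℝ), (ν x t = 0 ↔ x = 0)
  ν_smul : ∀ c : 𝕜, c ≠ 0 → ∀ x : V, ∀ t > (0:ℝ), ν (c • x) t = ν x (t / ‖c‖)
  ν_add : ∀ x y : V, ∀ s > (0:ℝ), ∀ t > (0:ℝ), ν (x + y) (s + t) ≤ dia (ν x s) (ν y t)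
  ν_anti : ∀ x : V, AntitoneOn (ν x) (Ioi 0)
  ν_tendsto : ∀ x : V, Tendsto (ν x) atTop (𝓝 0)

section Defs

variable {U V : Type*} [Sub U] [Sub V]

/-- A sequence `x` converges to `x₀` in an intuitionistic fuzzy normed linear space with
membership `μ` and non-membership `ν`. -/
def IFConverges (μ ν : V → ℝ → ℝ) (x : ℕ → V) (x₀ : V) : Prop :=
  ∀ t > (0:ℝ), Tendsto (fun n => μ (x n - x₀) t) atTop (𝓝 1) ∧
    Tendsto (fun n => ν (x n - x₀) t) atTop (𝓝 0)

/-- A sequence `x` is Cauchy in an intuitionistic fuzzy normed linear space. -/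
def IFCauchy (μ ν : V → ℝ → ℝ) (x : ℕ → V) : Prop :=
  ∀ t > (0:ℝ), ∀ p : ℕ, 0 < p →
    Tendsto (fun n => μ (x (n + p) - x n) t) atTop (𝓝 1) ∧
    Tendsto (fun n => ν (x (n + p) - x n) t) atTop (𝓝 0)

/-- Sequential intuitionistic fuzzy continuity at a point. -/
def SeqIFContinuousAt (μU νU : U → ℝ → ℝ) (μV νV : V → ℝ → ℝ) (f : U → V) (x₀ : U) : Prop :=
  ∀ x : ℕ → U, IFConverges μU νU x x₀ → IFConverges μV νV (fun n => f (x n)) (f x₀)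

/-- Sequential intuitionistic fuzzy continuity on all of `U`. -/
def SeqIFContinuous (μU νU : U → ℝ → ℝ) (μV νV : V → ℝ → ℝ) (f : U → V) : Prop :=
  ∀ x₀ : U, SeqIFContinuousAt μU νU μV νV f x₀

/-- Intuitionistic fuzzy continuity at a point (ε–δ definition). -/
def IFContinuousAt (μU νU : U → ℝ → ℝ) (μV νV : V → ℝ → ℝ) (f : U → V) (x₀ : U) : Prop :=
  ∀ ε > (0:ℝ), ∀ α ∈ Ioo (0:ℝ) 1, ∃ δ > (0:ℝ), ∃ β ∈ Ioo (0:ℝ) 1, ∀ x : U,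
    (1 - β < μU (x - x₀) δ → 1 - α < μV (f x - f x₀) ε) ∧
    (νU (x - x₀) δ < β → νV (f x - f x₀) ε < α)

/-- Intuitionistic fuzzy continuity on all of `U`. -/
def IFContinuous (μU νU : U → ℝ → ℝ) (μV νV : V → ℝ → ℝ) (f : U → V) : Prop :=
  ∀ x₀ : U, IFContinuousAt μU νU μV νV f x₀

/-- Uniform intuitionistic fuzzy continuity on all of `U`. -/
def UnifIFContinuous (μU νU : U → ℝ → ℝ) (μV νV : V → ℝ → ℝ) (f : U → V) : Prop :=
  ∀ ε > (0:ℝ), ∀ α ∈ Ioo (0:ℝ) 1, ∃ δ > (0:ℝ), ∃ β ∈ Ioo (0:ℝ) 1, ∀ x₁ x₂ : U,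
    1 - β < μU (x₁ - x₂) δ → νU (x₁ - x₂) δ < β →
    1 - α < μV (f x₁ - f x₂) ε ∧ νV (f x₁ - f x₂) ε < α

/-- Uniform intuitionistic fuzzy continuity on a subset `S` of `U`. -/
def UnifIFContinuousOn (μU νU : U → ℝ → ℝ) (μV νV : V → ℝ → ℝ) (f : U → V) (S : Set U) : Prop :=
  ∀ ε > (0:ℝ), ∀ α ∈ Ioo (0:ℝ) 1, ∃ δ > (0:ℝ), ∃ β ∈ Ioo (0:ℝ) 1, ∀ x₁ ∈ S, ∀ x₂ ∈ S,
    1 - β < μU (x₁ - x₂) δ → νU (x₁ - x₂) δ < β →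
    1 - α < μV (f x₁ - f x₂) ε ∧ νV (f x₁ - f x₂) ε < α

/-- The open ball `B(x, r, t)`. -/
def IFBall (μ ν : V → ℝ → ℝ) (x : V) (r t : ℝ) : Set V :=
  {y : V | 1 - r < μ (x - y) t ∧ ν (x - y) t < r}

/-- A set `G` is open in an intuitionistic fuzzy normed linear space. -/
def IFOpen (μ ν : V → ℝ → ℝ) (G : Set V) : Prop :=
  ∀ x ∈ G, ∃ r ∈ Ioo (0:ℝ) 1, ∃ t > (0:ℝ), IFBall μ ν x r t ⊆ G

/-- A set `N` is a neighbourhood of `x` in an intuitionistic fuzzy normed linear space. -/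
def IFNbhd (μ ν : V → ℝ → ℝ) (N : Set V) (x : V) : Prop :=
  ∃ r ∈ Ioo (0:ℝ) 1, ∃ t > (0:ℝ), IFBall μ ν x r t ⊆ N

/-- Pointwise intuitionistic fuzzy convergence of a sequence of functions. -/
def PointwiseIFConv (μV νV : V → ℝ → ℝ) (fn : ℕ → U → V) (f : U → V) : Prop :=
  ∀ x : U, IFConverges μV νV (fun n => fn n x) (f x)

/-- Uniform intuitionistic fuzzy convergence of a sequence of functions. -/
def UnifIFConv (μV νV : V → ℝ → ℝ) (fn : ℕ → U → V) (f : U → V) : Prop :=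
  ∀ r ∈ Ioo (0:ℝ) 1, ∀ t > (0:ℝ), ∃ n₀ : ℕ, ∀ x : U, ∀ n ≥ n₀,
    1 - r < μV (fn n x - f x) t ∧ νV (fn n x - f x) t < r

end Defs

/-- Membership function of the standard intuitionistic fuzzy norm with parameter `k`
on a normed linear space: `μ(x,t) = t/(t + k‖x‖)`. -/
noncomputable def stdμ {X : Type*} [Norm X] (k : ℝ) (x : X) (t : ℝ) : ℝ :=
  t / (t + k * ‖x‖)

/-- Non-membership function of the standard intuitionistic fuzzy norm with parameter `k`
on a normed linear space: `ν(x,t) = k‖x‖/(t + k‖x‖)`. -/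
noncomputable def stdν {X : Type*} [Norm X] (k : ℝ) (x : X) (t : ℝ) : ℝ :=
  (k * ‖x‖) / (t + k * ‖x‖)

theorem ifconv_iff_aux {star dia : ℝ → ℝ → ℝ} (B : IFNorm ℝ ℝ star dia) (x : ℕ → ℝ) (a : ℝ) :
    IFConverges B.μ B.ν x a ↔ Tendsto x atTop (𝓝 a) := by
  have hμ : ∀ y : ℝ, y ≠ 0 → ∀ t > (0:ℝ), B.μ y t = B.μ 1 (t / |y|) := by
    intro y hy t ht
    have := B.μ_smul y hy 1 t ht
    simpa using this
  have hν : ∀ y : ℝ, y ≠ 0 → ∀ t > (0:ℝ), B.ν y t = B.ν 1 (t / |y|) := by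
    intro y hy t ht
    have := B.ν_smul y hy 1 t ht
    simpa using this
  have key : ∀ h : Tendsto x atTop (𝓝 a), ∀ t > (0:ℝ), ∀ P : ℝ → Prop,
      (∀ᶠ T in atTop, P T) → ∀ᶠ n in atTop, x n - a ≠ 0 → P (t / |x n - a|) := by
    intro h t ht P hP
    obtain ⟨M, hM⟩ := eventually_atTop.1 hP
    have hM' : 0 < max M 1 := lt_of_lt_of_le one_pos (le_max_right _ _)
    have h2 := (Metric.tendsto_nhds.1 h) (t / max M 1) (by positivity)
    filter_upwards [h2] with n hn hne
    apply hM
    have hpos : 0 < |x n - a| := abs_pos.2 hne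
    rw [Real.dist_eq, lt_div_iff₀ hM'] at hn
    have : max M 1 ≤ t / |x n - a| := by
      rw [le_div_iff₀ hpos]; linarith
    exact (le_max_left _ _).trans this
  constructor
  · intro h
    rw [Metric.tendsto_nhds]
    intro ε hε
    have h1 := (h 1 one_pos).1
    have hlt : B.μ 1 (1 / ε) < 1 := by
      refine lt_of_le_of_ne (B.μ_mem 1 (1 / ε) (by positivity)).2 ?_
      intro he
      exact one_ne_zero ((B.μ_eq_one_iff 1 (1 / ε) (by positivity)).1 he)
    filter_upwards [h1.eventually (lt_mem_nhds hlt)] with n hn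
    by_contra! hc
    rw [Real.dist_eq] at hc
    have hpos : 0 < |x n - a| := lt_of_lt_of_le hε hc
    rw [hμ _ (abs_pos.1 hpos) 1 one_pos] at hn
    have := B.μ_mono 1 (show 1 / |x n - a| ∈ Ioi (0:ℝ) from by simp only [mem_Ioi]; positivity)
      (show 1 / ε ∈ Ioi (0:ℝ) from by simp only [mem_Ioi]; positivity)
      (one_div_le_one_div_of_le hε hc)
    linarith
  · intro h t ht
    constructor
    · intro s hs
      rw [mem_map]
      filter_upwards [key h t ht (fun T => B.μ 1 T ∈ s) (B.μ_tendsto 1 hs)] with n hn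
      by_cases h0 : x n - a = 0
      · have := (B.μ_eq_one_iff (x n - a) t ht).2 h0
        simp only [mem_preimage, this]
        exact mem_of_mem_nhds hs
      · simp only [mem_preimage, hμ _ h0 t ht]
        exact hn h0
    · intro s hs
      rw [mem_map]
      filter_upwards [key h t ht (fun T => B.ν 1 T ∈ s) (B.ν_tendsto 1 hs)] with n hn
      by_cases h0 : x n - a = 0
      · have := (B.ν_eq_zero_iff (x n - a) t ht).2 h0
        simp only [mem_preimage, this]
        exact mem_of_mem_nhds hs
      · simp only [mem_preimage, hν _ h0 t ht]
        exact hn h0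

/-- the product of two sequentially intuitionistic fuzzy continuous real-valued
functions is sequentially intuitionistic fuzzy continuous, under conditions (xii), (xv), (xvi). -/
theorem seqIFContinuous_mul {U : Type*} [AddCommGroup U] [Module ℝ U]
    {star dia : ℝ → ℝ → ℝ}
    (hstar : IsContinuousTNorm star) (hdia : IsContinuousTConorm dia)
    (hstar_idem : ∀ a ∈ Icc (0:ℝ) 1, star a a = a)
    (hdia_idem : ∀ a ∈ Icc (0:ℝ) 1, dia a a = a)
    (A : IFNorm ℝ U star dia) (B : IFNorm ℝ ℝ star dia)
    (hxv : ∀ x : ℝ, x ≠ 0 → ContinuousOn (B.μ x) (Ioi 0) ∧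
      StrictMonoOn (B.μ x) {t : ℝ | 0 < t ∧ 0 < B.μ x t ∧ B.μ x t < 1})
    (hxvi : ∀ x : ℝ, x ≠ 0 → ContinuousOn (B.ν x) (Ioi 0) ∧
      StrictAntiOn (B.ν x) {t : ℝ | 0 < t ∧ 0 < B.ν x t ∧ B.ν x t < 1})
    (f g : U → ℝ)
    (hf : SeqIFContinuous A.μ A.ν B.μ B.ν f)
    (hg : SeqIFContinuous A.μ A.ν B.μ B.ν g) :
    SeqIFContinuous A.μ A.ν B.μ B.ν (fun x => f x * g x) := by
  intro x₀ x hx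
  have h1 := (ifconv_iff_aux B _ _).1 (hf x₀ x hx)
  have h2 := (ifconv_iff_aux B _ _).1 (hg x₀ x hx)
  exact (ifconv_iff_aux B _ _).2 (h1.mul h2)
end

section
/- Let (U,A) be an intuitionistic fuzzy normed linear space over ℝ and let (V,B) be an intuitionistic fuzzy normed linear space over ℝ whose underlying linear space is ℝ itself, both with respect to the same continuous t-norm ∗ and continuous t-conorm ⋄ satisfying condition (xii), and suppose B satisfies conditions (xv) and (xvi). If g : U → ℝ is sequentially intuitionistic fuzzy continuous on U and g(x) ≠ 0 for all x ∈ U, then the function 1/g (given by x ↦ 1/g(x)) is sequentially intuitionistic fuzzy continuous on U. -/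
open Filter Topology Set

theorem IFaux_fwd {star dia : ℝ → ℝ → ℝ} (B : IFNorm ℝ ℝ star dia) (d : ℕ → ℝ)
    (h : Tendsto (fun n => B.μ (d n) 1) atTop (𝓝 1)) : Tendsto d atTop (𝓝 0) := by
  rw [Metric.tendsto_atTop']
  intro ε hε
  have hp : (0:ℝ) < 1 / ε := by positivity
  have h1 : B.μ 1 (1 / ε) < 1 := by
    refine lt_of_le_of_ne (B.μ_mem 1 _ hp).2 ?_
    intro h
    exact one_ne_zero ((B.μ_eq_one_iff 1 _ hp).1 h)
  obtain ⟨N, hN⟩ := eventually_atTop.1 (h.eventually (lt_mem_nhds h1))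
  refine ⟨N, fun n hn => ?_⟩
  have h2 := hN n hn.le
  rw [Real.dist_eq, sub_zero]
  by_contra hc
  push Not at hc
  have hd : 0 < |d n| := lt_of_lt_of_le hε hc
  have h3 := B.μ_smul (d n) (abs_pos.1 hd) 1 1 one_pos
  rw [smul_eq_mul, mul_one, Real.norm_eq_abs] at h3
  have h4 : B.μ 1 (1 / |d n|) ≤ B.μ 1 (1 / ε) :=
    B.μ_mono 1 (show (0:ℝ) < _ by positivity) hp (one_div_le_one_div_of_le hε hc)
  linarith

theorem IFaux_bwd {star dia : ℝ → ℝ → ℝ} (B : IFNorm ℝ ℝ star dia) (d : ℕ → ℝ)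
    (h : Tendsto d atTop (𝓝 0)) (t : ℝ) (ht : 0 < t) :
    Tendsto (fun n => B.μ (d n) t) atTop (𝓝 1) ∧
    Tendsto (fun n => B.ν (d n) t) atTop (𝓝 0) := by
  have key : ∀ T : ℝ, ∀ᶠ n in atTop, d n = 0 ∨ (d n ≠ 0 ∧ T ≤ t / ‖d n‖) := by
    intro T
    have hp : 0 < t / (|T| + 1) := by positivity
    have h0 : Tendsto (fun n => ‖d n‖) atTop (𝓝 0) := by simpa using h.norm
    filter_upwards [h0.eventually (gt_mem_nhds hp)] with n hn
    by_cases hd : d n = 0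
    · exact Or.inl hd
    · refine Or.inr ⟨hd, ?_⟩
      have hd' : 0 < ‖d n‖ := norm_pos_iff.2 hd
      rw [le_div_iff₀ hd']
      rw [lt_div_iff₀ (by positivity)] at hn
      nlinarith [le_abs_self T]
  constructor
  · rw [tendsto_def]
    intro s hs
    obtain ⟨T, hT⟩ := eventually_atTop.1 ((B.μ_tendsto 1).eventually hs)
    filter_upwards [key T] with n hn
    rcases hn with h0 | ⟨h0, h1⟩
    · have := (B.μ_eq_one_iff (d n) t ht).2 h0
      simpa [this] using mem_of_mem_nhds hs
    · have h3 := B.μ_smul (d n) h0 1 t ht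
      rw [smul_eq_mul, mul_one] at h3
      show B.μ (d n) t ∈ s
      rw [h3]; exact hT _ h1
  · rw [tendsto_def]
    intro s hs
    obtain ⟨T, hT⟩ := eventually_atTop.1 ((B.ν_tendsto 1).eventually hs)
    filter_upwards [key T] with n hn
    rcases hn with h0 | ⟨h0, h1⟩
    · have := (B.ν_eq_zero_iff (d n) t ht).2 h0
      simpa [this] using mem_of_mem_nhds hs
    · have h3 := B.ν_smul (d n) h0 1 t ht
      rw [smul_eq_mul, mul_one] at h3
      show B.ν (d n) t ∈ s
      rw [h3]; exact hT _ h1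

/-- if `g` is sequentially intuitionistic fuzzy continuous and nowhere zero,
then `1/g` is sequentially intuitionistic fuzzy continuous, under conditions (xii), (xv), (xvi). -/
theorem seqIFContinuous_inv {U : Type*} [AddCommGroup U] [Module ℝ U]
    {star dia : ℝ → ℝ → ℝ}
    (hstar : IsContinuousTNorm star) (hdia : IsContinuousTConorm dia)
    (hstar_idem : ∀ a ∈ Icc (0:ℝ) 1, star a a = a)
    (hdia_idem : ∀ a ∈ Icc (0:ℝ) 1, dia a a = a)
    (A : IFNorm ℝ U star dia) (B : IFNorm ℝ ℝ star dia)
    (hxv : ∀ x : ℝ, x ≠ 0 → ContinuousOn (B.μ x) (Ioi 0) ∧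
      StrictMonoOn (B.μ x) {t : ℝ | 0 < t ∧ 0 < B.μ x t ∧ B.μ x t < 1})
    (hxvi : ∀ x : ℝ, x ≠ 0 → ContinuousOn (B.ν x) (Ioi 0) ∧
      StrictAntiOn (B.ν x) {t : ℝ | 0 < t ∧ 0 < B.ν x t ∧ B.ν x t < 1})
    (g : U → ℝ) (hg0 : ∀ x : U, g x ≠ 0)
    (hg : SeqIFContinuous A.μ A.ν B.μ B.ν g) :
    SeqIFContinuous A.μ A.ν B.μ B.ν (fun x => (g x)⁻¹) := by
  intro x₀ x hx t ht
  have h1 := IFaux_fwd B _ (hg x₀ x hx 1 one_pos).1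
  have h2 : Tendsto (fun n => g (x n)) atTop (𝓝 (g x₀)) := tendsto_sub_nhds_zero_iff.1 h1
  have h3 := tendsto_sub_nhds_zero_iff.2 (h2.inv₀ (hg0 x₀))
  exact IFaux_bwd B _ h3 t ht
end

section
/- Let (U,A) be an intuitionistic fuzzy normed linear space over ℝ and let (V,B) be an intuitionistic fuzzy normed linear space over ℝ whose underlying linear space is ℝ itself, both with respect to the same continuous t-norm ∗ and continuous t-conorm ⋄ satisfying condition (xii), and suppose B satisfies conditions (xv) and (xvi). If f : U → ℝ and g : U → ℝ are sequentially intuitionistic fuzzy continuous on U and g(x) ≠ 0 for all x ∈ U, then the quotient function f/g is sequentially intuitionistic fuzzy continuous on U. -/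
open Filter Topology Set

theorem ifaux_tendsto (F : ℝ → ℝ → ℝ) (L t : ℝ) (ht : 0 < t) (h0 : F 0 t = L)
    (hs : ∀ d : ℝ, d ≠ 0 → F d t = F 1 (t / |d|)) (hL : Tendsto (F 1) atTop (𝓝 L)) :
    Tendsto (fun d => F d t) (𝓝 0) (𝓝 L) := by
  rw [← nhdsNE_sup_pure, tendsto_sup]
  constructor
  · have h1 : Tendsto (fun d : ℝ => t / |d|) (𝓝[≠] 0) atTop := by
      have h2 : Tendsto (fun d : ℝ => |d|) (𝓝[≠] 0) (𝓝[>] 0) := by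
        exact tendsto_abs_nhdsNE_zero
      have h3 := (tendsto_inv_nhdsGT_zero.comp h2).const_mul_atTop ht
      simpa [div_eq_mul_inv, Function.comp_def] using h3
    refine (hL.comp h1).congr' ?_
    filter_upwards [self_mem_nhdsWithin] with d hd
    exact (hs d hd).symm
  · rw [tendsto_pure_left]
    intro s hs'
    rw [h0]
    exact mem_of_mem_nhds hs'

theorem ifaux_iff {star dia : ℝ → ℝ → ℝ} (B : IFNorm ℝ ℝ star dia) (x : ℕ → ℝ) (x₀ : ℝ) :
    IFConverges B.μ B.ν x x₀ ↔ Tendsto x atTop (𝓝 x₀) := by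
  have hμ : ∀ t > (0:ℝ), ∀ d : ℝ, d ≠ 0 → B.μ d t = B.μ 1 (t / |d|) := by
    intro t ht d hd
    have := B.μ_smul d hd 1 t ht
    simpa using this
  have hν : ∀ t > (0:ℝ), ∀ d : ℝ, d ≠ 0 → B.ν d t = B.ν 1 (t / |d|) := by
    intro t ht d hd
    have := B.ν_smul d hd 1 t ht
    simpa using this
  constructor
  · intro h
    rw [Metric.tendsto_atTop']
    intro ε hε
    have hlt : B.μ 1 (1 / ε) < 1 := by
      refine lt_of_le_of_ne (B.μ_mem 1 _ (by positivity)).2 ?_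
      rw [Ne, B.μ_eq_one_iff 1 _ (by positivity)]
      exact one_ne_zero
    obtain ⟨N, hN⟩ := eventually_atTop.1 ((h 1 one_pos).1.eventually (lt_mem_nhds hlt))
    refine ⟨N, fun n hn => ?_⟩
    have h1 := hN n hn.le
    rw [Real.dist_eq]
    by_contra hc
    push Not at hc
    have hd : 0 < |x n - x₀| := hε.trans_le hc
    rw [hμ 1 one_pos _ (abs_pos.1 hd)] at h1
    have h2 := B.μ_mono 1 (a := 1 / |x n - x₀|) (b := 1 / ε)
      (by simp only [mem_Ioi]; positivity) (by simp only [mem_Ioi]; positivity)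
      (one_div_le_one_div_of_le hε hc)
    linarith
  · intro h t ht
    have hd : Tendsto (fun n => x n - x₀) atTop (𝓝 0) := by
      simpa using h.sub_const x₀
    exact ⟨(ifaux_tendsto B.μ 1 t ht ((B.μ_eq_one_iff 0 t ht).2 rfl) (hμ t ht)
        (B.μ_tendsto 1)).comp hd,
      (ifaux_tendsto B.ν 0 t ht ((B.ν_eq_zero_iff 0 t ht).2 rfl) (hν t ht)
        (B.ν_tendsto 1)).comp hd⟩

/-- if `f`, `g` are sequentially intuitionistic fuzzy continuous and `g` is
nowhere zero, then `f/g` is sequentially intuitionistic fuzzy continuous, under conditions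
(xii), (xv), (xvi). -/
theorem seqIFContinuous_div {U : Type*} [AddCommGroup U] [Module ℝ U]
    {star dia : ℝ → ℝ → ℝ}
    (hstar : IsContinuousTNorm star) (hdia : IsContinuousTConorm dia)
    (hstar_idem : ∀ a ∈ Icc (0:ℝ) 1, star a a = a)
    (hdia_idem : ∀ a ∈ Icc (0:ℝ) 1, dia a a = a)
    (A : IFNorm ℝ U star dia) (B : IFNorm ℝ ℝ star dia)
    (hxv : ∀ x : ℝ, x ≠ 0 → ContinuousOn (B.μ x) (Ioi 0) ∧
      StrictMonoOn (B.μ x) {t : ℝ | 0 < t ∧ 0 < B.μ x t ∧ B.μ x t < 1})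
    (hxvi : ∀ x : ℝ, x ≠ 0 → ContinuousOn (B.ν x) (Ioi 0) ∧
      StrictAntiOn (B.ν x) {t : ℝ | 0 < t ∧ 0 < B.ν x t ∧ B.ν x t < 1})
    (f g : U → ℝ) (hg0 : ∀ x : U, g x ≠ 0)
    (hf : SeqIFContinuous A.μ A.ν B.μ B.ν f)
    (hg : SeqIFContinuous A.μ A.ν B.μ B.ν g) :
    SeqIFContinuous A.μ A.ν B.μ B.ν (fun x => f x / g x) := by
  intro x₀ x hx
  exact (ifaux_iff B _ _).2 (((ifaux_iff B _ _).1 (hf x₀ x hx)).div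
    ((ifaux_iff B _ _).1 (hg x₀ x hx)) (hg0 x₀))
end

section
/- Let V = ℝ with the norm ‖x‖ = |x|, let k > 0, and let A be the standard intuitionistic fuzzy norm with parameter k on V. Then a function f : ℝ → ℝ is continuous on (V, ‖·‖) in the usual sense if and only if f is intuitionistic fuzzy continuous on (V, A). -/
open Filter Topology Set

theorem stdν_lt_aux (k : ℝ) (hk : 0 < k) (x t b : ℝ) (ht : 0 < t) :
    stdν k x t < b ↔ ‖x‖ * (k * (1 - b)) < b * t := by
  have h : 0 < t + k * ‖x‖ := by positivity
  unfold stdν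
  rw [div_lt_iff₀ h]
  constructor <;> intro h <;> linarith

theorem stdμ_gt_aux (k : ℝ) (hk : 0 < k) (x t b : ℝ) (ht : 0 < t) :
    1 - b < stdμ k x t ↔ ‖x‖ * (k * (1 - b)) < b * t := by
  have h : 0 < t + k * ‖x‖ := by positivity
  unfold stdμ
  rw [lt_div_iff₀ h]
  constructor <;> intro h <;> linarith

/-- for `V = ℝ` with the standard intuitionistic fuzzy norm with parameter
`k > 0`, a function `f : ℝ → ℝ` is continuous in the usual sense if and only if it is
intuitionistic fuzzy continuous. -/
theorem continuous_iff_ifContinuous_std (k : ℝ) (hk : 0 < k) (f : ℝ → ℝ) :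
    Continuous f ↔
      IFContinuous (U := ℝ) (V := ℝ) (stdμ k) (stdν k) (stdμ k) (stdν k) f := by
  rw [Metric.continuous_iff]
  constructor
  · intro hf x₀ ε hε α hα
    have h1 : 0 < k * (1 - α) := mul_pos hk (by linarith [hα.2])
    obtain ⟨d, hd, H⟩ := hf x₀ (α * ε / (k * (1 - α))) (div_pos (mul_pos hα.1 hε) h1)
    have hkd : 0 < k * d := mul_pos hk hd
    refine ⟨k * d, hkd, 1 / 2, ⟨by norm_num, by norm_num⟩, fun x => ?_⟩
    rw [stdμ_gt_aux k hk _ _ _ hkd, stdμ_gt_aux k hk _ _ _ hε,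
      stdν_lt_aux k hk _ _ _ hkd, stdν_lt_aux k hk _ _ _ hε, and_self]
    intro h
    have h2 : ‖x - x₀‖ < d := by
      by_contra hc
      have := mul_le_mul_of_nonneg_left (not_lt.mp hc) hk.le
      linarith
    have h3 := H x (by rwa [dist_eq_norm])
    rwa [dist_eq_norm, lt_div_iff₀ h1] at h3
  · intro hf x₀ ε hε
    have hkε : 0 < k * ε := mul_pos hk hε
    obtain ⟨δ, hδ, β, hβ, H⟩ := hf x₀ (k * ε) hkε (1 / 2) ⟨by norm_num, by norm_num⟩
    have h1 : 0 < k * (1 - β) := mul_pos hk (by linarith [hβ.2])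
    refine ⟨β * δ / (k * (1 - β)), div_pos (mul_pos hβ.1 hδ) h1, fun x hx => ?_⟩
    rw [dist_eq_norm, lt_div_iff₀ h1] at hx
    have h2 := (H x).2
    rw [stdν_lt_aux k hk _ _ _ hδ, stdν_lt_aux k hk _ _ _ hkε] at h2
    have h3 := h2 hx
    rw [dist_eq_norm]
    by_contra hc
    have := mul_le_mul_of_nonneg_left (not_lt.mp hc) hk.le
    linarith
end

section
/- Let (U,A) and (V,B) be intuitionistic fuzzy normed linear spaces over the same field with respect to the same continuous t-norm ∗ and continuous t-conorm ⋄, and let f : U → V be uniformly intuitionistic fuzzy continuous on U. If (xₙ) is a Cauchy sequence in (U,A), then (f(xₙ)) is a Cauchy sequence in (V,B). -/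
open Filter Topology Set

/-- a uniformly intuitionistic fuzzy continuous map sends Cauchy sequences of
`(U,A)` to Cauchy sequences of `(V,B)`. -/
theorem unifIFContinuous_cauchy {𝕜 U V : Type*} [RCLike 𝕜]
    [AddCommGroup U] [Module 𝕜 U] [AddCommGroup V] [Module 𝕜 V]
    {star dia : ℝ → ℝ → ℝ}
    (hstar : IsContinuousTNorm star) (hdia : IsContinuousTConorm dia)
    (A : IFNorm 𝕜 U star dia) (B : IFNorm 𝕜 V star dia)
    (f : U → V) (hf : UnifIFContinuous A.μ A.ν B.μ B.ν f)
    (x : ℕ → U) (hx : IFCauchy A.μ A.ν x) :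
    IFCauchy B.μ B.ν (fun n => f (x n)) := by
  intro t ht p hp
  have key : ∀ α ∈ Ioo (0:ℝ) 1, ∀ᶠ n in atTop,
      1 - α < B.μ (f (x (n + p)) - f (x n)) t ∧ B.ν (f (x (n + p)) - f (x n)) t < α := by
    intro α hα
    obtain ⟨δ, hδ, β, hβ, h⟩ := hf t ht α hα
    obtain ⟨h1, h2⟩ := hx δ hδ p hp
    filter_upwards [h1.eventually (lt_mem_nhds (show 1 - β < 1 by linarith [hβ.1])),
      h2.eventually (gt_mem_nhds hβ.1)] with n hn1 hn2
    exact h _ _ hn1 hn2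
  have small : ∀ c : ℝ, 0 < c → ∃ α ∈ Ioo (0:ℝ) 1, α ≤ c := fun c hc =>
    ⟨min c (1 / 2), ⟨lt_min hc (by norm_num), (min_le_right _ _).trans_lt (by norm_num)⟩,
      min_le_left _ _⟩
  constructor
  · refine tendsto_order.2 ⟨fun a ha => ?_, fun a ha => Eventually.of_forall fun n =>
      (B.μ_mem _ t ht).2.trans_lt ha⟩
    obtain ⟨α, hα, hc⟩ := small (1 - a) (by linarith)
    filter_upwards [key α hα] with n hn
    linarith [hn.1]
  · refine tendsto_order.2 ⟨fun a ha => Eventually.of_forall fun n =>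
      ha.trans_le (B.ν_mem _ t ht).1, fun a ha => ?_⟩
    obtain ⟨α, hα, hc⟩ := small a ha
    filter_upwards [key α hα] with n hn
    linarith [hn.2]
end

section
/- Let (U, ‖·‖₁) and (V, ‖·‖₂) be normed linear spaces over K (= ℝ or ℂ), let k > 0, and let A and B be the standard intuitionistic fuzzy norms with parameter k on U and V respectively. Then a sequence of functions fₙ : U → V is uniformly intuitionistic fuzzy convergent on U to f : U → V (with respect to B) if and only if (fₙ) converges to f uniformly on U with respect to the norm ‖·‖₂, i.e. sup_{x ∈ U} ‖fₙ(x) − f(x)‖₂ → 0 as n → ∞. -/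
open Filter Topology Set

/-- for normed linear spaces `U`, `V` over `K` with the standard
intuitionistic fuzzy norms with parameter `k > 0`, a sequence of functions `fₙ : U → V`
is uniformly intuitionistic fuzzy convergent to `f` iff it converges to `f` uniformly
with respect to the norm of `V`. -/
theorem unifIFConv_iff_unif_norm_conv {K U V : Type*} [RCLike K]
    [NormedAddCommGroup U] [NormedSpace K U] [NormedAddCommGroup V] [NormedSpace K V]
    (k : ℝ) (hk : 0 < k) (fn : ℕ → U → V) (f : U → V) :
    UnifIFConv (U := U) (stdμ (X := V) k) (stdν (X := V) k) fn f ↔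
      ∀ ε > (0:ℝ), ∃ n₀ : ℕ, ∀ n ≥ n₀, ∀ x : U, ‖fn n x - f x‖ < ε := by
  constructor
  · intro h ε hε
    obtain ⟨n₀, hn⟩ := h (1/2) ⟨by norm_num, by norm_num⟩ (k * ε) (by positivity)
    refine ⟨n₀, fun n hnn x => ?_⟩
    have h2 := (hn x n hnn).2
    unfold stdν at h2
    have hN := norm_nonneg (fn n x - f x)
    rw [div_lt_iff₀ (by positivity)] at h2
    have h3 : k * ‖fn n x - f x‖ < k * ε := by linarith
    exact lt_of_mul_lt_mul_left h3 hk.le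
  · intro h r hr t ht
    obtain ⟨hr0, hr1⟩ := hr
    obtain ⟨n₀, hn⟩ := h (r * t / k) (by positivity)
    refine ⟨n₀, fun x n hnn => ?_⟩
    have h1 := hn n hnn x
    rw [lt_div_iff₀ hk] at h1
    have hN : 0 ≤ k * ‖fn n x - f x‖ := by positivity
    have hrN : 0 ≤ r * (k * ‖fn n x - f x‖) := by positivity
    unfold stdμ stdν
    constructor
    · rw [lt_div_iff₀ (by positivity)]
      linarith
    · rw [div_lt_iff₀ (by positivity)]
      linarith
end

section
/- Uniform Limit Theorem: Let (U,A) and (V,B) be intuitionistic fuzzy normed linear spaces over the same field with respect to the same continuous t-norm ∗ and continuous t-conorm ⋄ satisfying condition (xii). Let fₙ : U → V for n ∈ ℕ, and suppose each fₙ is intuitionistic fuzzy continuous on U. If (fₙ) is uniformly intuitionistic fuzzy convergent on U to a function f : U → V, then f is intuitionistic fuzzy continuous on U. -/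
open Filter Topology Set

theorem IFNorm.lt_μ_add {𝕜 V : Type*} [RCLike 𝕜] [AddCommGroup V] [Module 𝕜 V]
    {star dia : ℝ → ℝ → ℝ} (hstar : IsContinuousTNorm star)
    (hstar_idem : ∀ a ∈ Icc (0:ℝ) 1, star a a = a)
    (B : IFNorm 𝕜 V star dia) (x y : V) (s t c : ℝ) (hs : 0 < s) (ht : 0 < t)
    (h1 : c < B.μ x s) (h2 : c < B.μ y t) : c < B.μ (x + y) (s + t) := by
  have m1 := B.μ_mem x s hs
  have m2 := B.μ_mem y t ht
  have hm : min (B.μ x s) (B.μ y t) ∈ Icc (0:ℝ) 1 :=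
    ⟨le_min m1.1 m2.1, (min_le_left _ _).trans m1.2⟩
  have h3 := hstar.mono _ hm _ hm _ m1 _ m2 (min_le_left _ _) (min_le_right _ _)
  rw [hstar_idem _ hm] at h3
  exact (lt_min h1 h2).trans_le (h3.trans (B.μ_add x y s hs t ht))

theorem IFNorm.ν_add_lt {𝕜 V : Type*} [RCLike 𝕜] [AddCommGroup V] [Module 𝕜 V]
    {star dia : ℝ → ℝ → ℝ} (hdia : IsContinuousTConorm dia)
    (hdia_idem : ∀ a ∈ Icc (0:ℝ) 1, dia a a = a)
    (B : IFNorm 𝕜 V star dia) (x y : V) (s t c : ℝ) (hs : 0 < s) (ht : 0 < t)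
    (h1 : B.ν x s < c) (h2 : B.ν y t < c) : B.ν (x + y) (s + t) < c := by
  have m1 := B.ν_mem x s hs
  have m2 := B.ν_mem y t ht
  have hm : max (B.ν x s) (B.ν y t) ∈ Icc (0:ℝ) 1 :=
    ⟨m1.1.trans (le_max_left _ _), max_le m1.2 m2.2⟩
  have h3 := hdia.mono _ m1 _ m2 _ hm _ hm (le_max_left _ _) (le_max_right _ _)
  rw [hdia_idem _ hm] at h3
  exact ((B.ν_add x y s hs t ht).trans h3).trans_lt (max_lt h1 h2)

theorem IFNorm.μ_sub_comm {𝕜 V : Type*} [RCLike 𝕜] [AddCommGroup V] [Module 𝕜 V]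
    {star dia : ℝ → ℝ → ℝ} (B : IFNorm 𝕜 V star dia) (x y : V) (t : ℝ) (ht : 0 < t) :
    B.μ (x - y) t = B.μ (y - x) t := by
  have h := B.μ_smul (-1) (by simp) (y - x) t ht
  simpa using h

theorem IFNorm.ν_sub_comm {𝕜 V : Type*} [RCLike 𝕜] [AddCommGroup V] [Module 𝕜 V]
    {star dia : ℝ → ℝ → ℝ} (B : IFNorm 𝕜 V star dia) (x y : V) (t : ℝ) (ht : 0 < t) :
    B.ν (x - y) t = B.ν (y - x) t := by
  have h := B.ν_smul (-1) (by simp) (y - x) t ht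
  simpa using h

/-- Uniform Limit Theorem: if each `fₙ` is intuitionistic fuzzy continuous
on `U` and `(fₙ)` is uniformly intuitionistic fuzzy convergent on `U` to `f`, then `f` is
intuitionistic fuzzy continuous on `U` (condition (xii) assumed). -/
theorem uniform_limit_ifContinuous {𝕜 U V : Type*} [RCLike 𝕜]
    [AddCommGroup U] [Module 𝕜 U] [AddCommGroup V] [Module 𝕜 V]
    {star dia : ℝ → ℝ → ℝ}
    (hstar : IsContinuousTNorm star) (hdia : IsContinuousTConorm dia)
    (hstar_idem : ∀ a ∈ Icc (0:ℝ) 1, star a a = a)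
    (hdia_idem : ∀ a ∈ Icc (0:ℝ) 1, dia a a = a)
    (A : IFNorm 𝕜 U star dia) (B : IFNorm 𝕜 V star dia)
    (fn : ℕ → U → V) (f : U → V)
    (hfn : ∀ n : ℕ, IFContinuous A.μ A.ν B.μ B.ν (fn n))
    (hconv : UnifIFConv (U := U) B.μ B.ν fn f) :
    IFContinuous A.μ A.ν B.μ B.ν f := by
  intro x₀ ε hε α hα
  have h3 : 0 < ε / 3 := by positivity
  obtain ⟨n, hn⟩ := hconv α hα (ε / 3) h3
  obtain ⟨δ, hδ, β, hβ, hc⟩ := hfn n x₀ (ε / 3) h3 α hα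
  refine ⟨δ, hδ, β, hβ, fun x => ?_⟩
  have e1 : f x - f x₀ = ((f x - fn n x) + (fn n x - fn n x₀)) + (fn n x₀ - f x₀) := by abel
  have e2 : ε = (ε / 3 + ε / 3) + ε / 3 := by ring
  have ha := hn x n le_rfl
  have hb := hn x₀ n le_rfl
  rw [B.μ_sub_comm _ _ _ h3, B.ν_sub_comm _ _ _ h3] at ha
  constructor
  · intro h
    rw [e1, e2]
    exact B.lt_μ_add hstar hstar_idem _ _ _ _ _ (by positivity) h3
      (B.lt_μ_add hstar hstar_idem _ _ _ _ _ h3 h3 ha.1 ((hc x).1 h)) hb.1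
  · intro h
    rw [e1, e2]
    exact B.ν_add_lt hdia hdia_idem _ _ _ _ _ (by positivity) h3
      (B.ν_add_lt hdia hdia_idem _ _ _ _ _ h3 h3 ha.2 ((hc x).2 h)) hb.2
end
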